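/- Let 𝒬 be the space of real symmetric traceless 3×3 matrices, let 𝒬_phy° = {Q ∈ 𝒬 : every eigenvalue of Q lies in (−1/3, 2/3)}, and let f_b : 𝒬_phy° → ℝ be smooth, convex, with f_b ≥ 1 on 𝒬_phy°, and such that f_b(Qₙ) → +∞ whenever Qₙ ∈ 𝒬_phy° converges to a point of the boundary of 𝒬_phy. Then there exists a sequence of functions fₙ : 𝒬 → ℝ such that: each fₙ is nonnegative on all of 𝒬; each fₙ is convex and smooth on all of 𝒬; fₙ(Q) ≤ f_b(Q) for every Q ∈ 𝒬_phy°; and fₙ → f_b and the gradients Dfₙ → Df_b uniformly on compact subsets of 𝒬_phy°. -/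

import Mathlib

open Matrix Filter

attribute [local instance] Matrix.frobeniusNormedAddCommGroup Matrix.frobeniusNormedSpace

/-- `𝒬`: the space of real symmetric traceless 3×3 matrices, as a submodule of the matrices
(a finite-dimensional normed space under the Frobenius norm). -/
def QSub : Submodule ℝ (Matrix (Fin 3) (Fin 3) ℝ) where
  carrier := {Q | Q.IsSymm ∧ Q.trace = 0}
  add_mem' := by
    rintro a b ⟨ha1, ha2⟩ ⟨hb1, hb2⟩
    refine ⟨?_, by simp [Matrix.trace_add, ha2, hb2]⟩
    simpa [Matrix.IsSymm, Matrix.transpose_add] using congrArg₂ (· + ·) ha1 hb1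
  zero_mem' := ⟨by simp [Matrix.IsSymm], by simp⟩
  smul_mem' := by
    rintro c a ⟨h1, h2⟩
    refine ⟨?_, by simp [Matrix.trace_smul, h2]⟩
    simpa [Matrix.IsSymm, Matrix.transpose_smul] using congrArg (c • ·) h1

/-- `𝒬_phy` as a subset of `𝒬`: all eigenvalues lie in `[-1/3, 2/3]`. -/
def QPhy : Set QSub :=
  {Q | spectrum ℝ (Q : Matrix (Fin 3) (Fin 3) ℝ) ⊆ Set.Icc (-(1:ℝ)/3) (2/3)}

/-- `𝒬_phy°`: all eigenvalues lie in the open interval `(-1/3, 2/3)`. -/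
def QPhyInt : Set QSub :=
  {Q | spectrum ℝ (Q : Matrix (Fin 3) (Fin 3) ℝ) ⊆ Set.Ioo (-(1:ℝ)/3) (2/3)}

theorem convexOn_log_sum_exp {E ι : Type*} [AddCommGroup E] [Module ℝ E] {S : Set E}
    {s : Finset ι} (hs : s.Nonempty) {l : ι → E → ℝ} (hl : ∀ i ∈ s, ConvexOn ℝ S (l i)) :
    ConvexOn ℝ S (fun x => Real.log (∑ i ∈ s, Real.exp (l i x))) := by
  have hpos (x : E) : 0 < ∑ i ∈ s, Real.exp (l i x) :=
    Finset.sum_pos (fun i _ => Real.exp_pos _) hs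
  have hnorm (x : E) :
      ∑ i ∈ s, Real.exp (l i x - Real.log (∑ i ∈ s, Real.exp (l i x))) = 1 := by
    simp_rw [Real.exp_sub, Real.exp_log (hpos x), ← Finset.sum_div]
    exact div_self (hpos x).ne'
  obtain ⟨i₀, hi₀⟩ := hs
  refine ⟨(hl i₀ hi₀).1, fun x hx y hy a b ha hb hab => ?_⟩
  simp only [smul_eq_mul]
  set A := Real.log (∑ i ∈ s, Real.exp (l i x)) with hA
  set B := Real.log (∑ i ∈ s, Real.exp (l i y)) with hB
  rw [Real.log_le_iff_le_exp (hpos _)]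
  calc ∑ i ∈ s, Real.exp (l i (a • x + b • y))
      ≤ ∑ i ∈ s, Real.exp (a * A + b * B) *
          (a * Real.exp (l i x - A) + b * Real.exp (l i y - B)) := by
        refine Finset.sum_le_sum fun i hi => ?_
        have h1 : l i (a • x + b • y) ≤ a * l i x + b * l i y :=
          (hl i hi).2 hx hy ha hb hab
        have h2 : Real.exp (a * (l i x - A) + b * (l i y - B)) ≤
            a * Real.exp (l i x - A) + b * Real.exp (l i y - B) :=
          convexOn_exp.2 (Set.mem_univ _) (Set.mem_univ _) ha hb hab
        calc Real.exp (l i (a • x + b • y))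
            ≤ Real.exp ((a * A + b * B) + (a * (l i x - A) + b * (l i y - B))) :=
              Real.exp_le_exp.2 (by linarith)
          _ ≤ _ := by
              rw [Real.exp_add]
              gcongr
    _ = Real.exp (a * A + b * B) := by
        rw [← Finset.mul_sum, Finset.sum_add_distrib, ← Finset.mul_sum, ← Finset.mul_sum,
          hnorm x, hnorm y, mul_one, mul_one, hab, mul_one]

/-- A finite maximum of smooth convex functions can be approximated uniformly from below by a
smooth convex function. -/
theorem exists_contDiff_convexOn_approx_sup {E ι : Type*} [NormedAddCommGroup E]
    [NormedSpace ℝ E] {n : WithTop ℕ∞} {s : Finset ι} (hs : s.Nonempty) {l : ι → E → ℝ}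
    (hsmooth : ∀ i ∈ s, ContDiff ℝ n (l i)) (hconv : ∀ i ∈ s, ConvexOn ℝ Set.univ (l i))
    {ε : ℝ} (hε : 0 < ε) :
    ∃ F : E → ℝ, ContDiff ℝ n F ∧ ConvexOn ℝ Set.univ F ∧
      ∀ x, (∀ i ∈ s, l i x - ε ≤ F x) ∧ ∃ i ∈ s, F x ≤ l i x := by
  obtain ⟨c, hc, hcε⟩ : ∃ c : ℝ, 0 < c ∧ c⁻¹ * Real.log s.card ≤ ε := by
    have hlog : 0 ≤ Real.log s.card := Real.log_natCast_nonneg _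
    refine ⟨(Real.log s.card + 1) / ε, by positivity, ?_⟩
    rw [inv_div, div_mul_eq_mul_div, div_le_iff₀ (by positivity)]
    nlinarith
  have hpos (x : E) : 0 < ∑ i ∈ s, Real.exp (c * l i x) :=
    Finset.sum_pos (fun i _ => Real.exp_pos _) hs
  have hcard : (0 : ℝ) < s.card := by exact_mod_cast hs.card_pos
  refine ⟨fun x => c⁻¹ * Real.log (∑ i ∈ s, Real.exp (c * l i x)) + -(c⁻¹ * Real.log s.card),
    ?_, ?_, fun x => ⟨fun i hi => ?_, ?_⟩⟩
  · refine (contDiff_const.mul (ContDiff.log (ContDiff.sum fun i hi => ?_)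
      fun x => (hpos x).ne')).add contDiff_const
    exact (contDiff_const.mul (hsmooth i hi)).exp
  · refine ConvexOn.add_const (ConvexOn.smul (inv_nonneg.2 hc.le) ?_) _
    exact convexOn_log_sum_exp hs fun i hi => (hconv i hi).smul hc.le
  · have h : c * l i x ≤ Real.log (∑ i ∈ s, Real.exp (c * l i x)) := by
      rw [Real.le_log_iff_exp_le (hpos x)]
      exact Finset.single_le_sum (f := fun i => Real.exp (c * l i x))
        (fun j _ => (Real.exp_pos _).le) hi
    have h' : l i x ≤ c⁻¹ * Real.log (∑ i ∈ s, Real.exp (c * l i x)) := by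
      rwa [← div_eq_inv_mul, le_div_iff₀' hc]
    linarith
  · obtain ⟨i, hi, hmax⟩ := s.exists_max_image (fun i => l i x) hs
    refine ⟨i, hi, ?_⟩
    have h : Real.log (∑ i ∈ s, Real.exp (c * l i x)) ≤ Real.log s.card + c * l i x := by
      rw [Real.log_le_iff_le_exp (hpos x), Real.exp_add, Real.exp_log hcard, ← nsmul_eq_mul]
      exact Finset.sum_le_card_nsmul _ _ _ fun j hj =>
        Real.exp_le_exp.2 (mul_le_mul_of_nonneg_left (hmax j hj) hc.le)
    have h' := mul_le_mul_of_nonneg_left h (inv_nonneg.2 hc.le)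
    rw [mul_add, inv_mul_cancel_left₀ hc.ne'] at h'
    linarith

theorem ConvexOn.add_fderiv_le {E : Type*} [NormedAddCommGroup E] [NormedSpace ℝ E]
    {S : Set E} {f : E → ℝ} (hf : ConvexOn ℝ S f) {x y : E} (hx : x ∈ S) (hy : y ∈ S)
    (hd : DifferentiableAt ℝ f x) : f x + fderiv ℝ f x (y - x) ≤ f y := by
  have hg : ConvexOn ℝ (AffineMap.lineMap (k := ℝ) x y ⁻¹' S)
      (f ∘ AffineMap.lineMap (k := ℝ) x y) := hf.comp_affineMap _
  have hd' : HasFDerivAt f (fderiv ℝ f x) (AffineMap.lineMap (k := ℝ) x y (0 : ℝ)) := by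
    simpa using hd.hasFDerivAt
  have := hg.le_slope_of_hasDerivAt (x := 0) (y := 1) (by simpa) (by simpa) one_pos
    (hd'.comp_hasDerivAt _ AffineMap.hasDerivAt_lineMap)
  simp [slope] at this
  linarith [map_sub (fderiv ℝ f x) y x]

/-- If convex functions converge to a convex `C¹` function uniformly on the compact subsets of an
open set, then so do their derivatives. -/
theorem tendstoUniformlyOn_fderiv_of_convexOn {E ι : Type*} [NormedAddCommGroup E]
    [NormedSpace ℝ E] [ProperSpace E] {U K : Set E} (hU : IsOpen U) {f : E → ℝ}
    (hf : ContDiffOn ℝ 1 f U) (hconv : ConvexOn ℝ U f) {F : ι → E → ℝ} {p : Filter ι}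
    (hFd : ∀ n, Differentiable ℝ (F n)) (hFc : ∀ n, ConvexOn ℝ Set.univ (F n))
    (hF : ∀ C ⊆ U, IsCompact C → TendstoUniformlyOn F f p C) (hKU : K ⊆ U) (hK : IsCompact K) :
    TendstoUniformlyOn (fun n => fderiv ℝ (F n)) (fderiv ℝ f) p K := by
  obtain ⟨δ, hδ, hCU⟩ := hK.exists_cthickening_subset_open hU hKU
  have hC : IsCompact (Metric.cthickening δ K) := hK.cthickening
  have huc := hC.uniformContinuousOn_of_continuous
    ((hf.continuousOn_fderiv_of_isOpen hU le_rfl).mono hCU)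
  rw [Metric.tendstoUniformlyOn_iff]
  intro η hη
  obtain ⟨r, hr, hrC⟩ := Metric.uniformContinuousOn_iff.1 huc (η / 4) (by positivity)
  obtain ⟨t, ht, htδ, htr⟩ : ∃ t > 0, t ≤ δ ∧ t < r :=
    ⟨min δ (r / 2), by positivity, min_le_left _ _, (min_le_right _ _).trans_lt (by linarith)⟩
  filter_upwards [Metric.tendstoUniformlyOn_iff.1 (hF _ hCU hC) (η * t / 8) (by positivity)]
    with n hn x hx
  have hxC : x ∈ Metric.cthickening δ K := Metric.self_subset_cthickening K hx
  have key (v : E) (hv : ‖v‖ = 1) : fderiv ℝ (F n) x v - fderiv ℝ f x v ≤ η / 2 := by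
    have hdist : dist (x + t • v) x = t := by
      rw [dist_self_add_left, norm_smul, hv, Real.norm_of_nonneg ht.le, mul_one]
    have hyC : x + t • v ∈ Metric.cthickening δ K :=
      Metric.mem_cthickening_of_dist_le _ x δ K hx (hdist.trans_le htδ)
    have h1 := (hFc n).add_fderiv_le (Set.mem_univ x) (Set.mem_univ (x + t • v)) (hFd n x)
    have h2 := hconv.add_fderiv_le (hCU hyC) (hCU hxC)
      ((hf.contDiffAt (hU.mem_nhds (hCU hyC))).differentiableAt one_ne_zero)
    rw [add_sub_cancel_left, map_smul, smul_eq_mul] at h1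
    rw [sub_add_cancel_left, map_neg, map_smul, smul_eq_mul] at h2
    have h3 := (abs_lt.1 (hn _ hyC)).1
    have h4 := (abs_lt.1 (hn _ hxC)).2
    have h5 : fderiv ℝ f (x + t • v) v - fderiv ℝ f x v ≤ η / 4 := by
      have := (fderiv ℝ f (x + t • v) - fderiv ℝ f x).le_opNorm v
      rw [hv, mul_one, ← dist_eq_norm] at this
      exact ((le_abs_self _).trans this).trans
        (hrC _ hyC _ hxC (hdist.trans_lt htr)).le
    have h6 : t * (fderiv ℝ (F n) x v - fderiv ℝ f (x + t • v) v) ≤ t * (η / 4) := by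
      linarith
    linarith [le_of_mul_le_mul_left h6 ht]
  rw [dist_comm, dist_eq_norm]
  refine lt_of_le_of_lt (ContinuousLinearMap.opNorm_le_of_unit_norm (by positivity)
    fun v hv => abs_le.2 ⟨?_, key v hv⟩) (half_lt_self hη)
  have := key (-v) (by rwa [norm_neg])
  simp only [map_neg] at this
  rw [_root_.sub_apply]
  linarith

/-- On a compact subset, a differentiable convex function bounded below by `1` is approximated
from below by nonnegative smooth convex functions defined on the whole space. -/
theorem ConvexOn.exists_contDiff_approx_of_isCompact {E : Type*} [NormedAddCommGroup E]
    [NormedSpace ℝ E] {U K : Set E} (hU : IsOpen U) {f : E → ℝ} (hf : DifferentiableOn ℝ f U)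
    (hconv : ConvexOn ℝ U f) (hlb : ∀ x ∈ U, 1 ≤ f x) (hKU : K ⊆ U) (hK : IsCompact K)
    {ε : ℝ} (hε : 0 < ε) (hε1 : ε ≤ 1) {n : WithTop ℕ∞} :
    ∃ F : E → ℝ, (∀ x, 0 ≤ F x) ∧ ConvexOn ℝ Set.univ F ∧ ContDiff ℝ n F ∧
      (∀ x ∈ U, F x ≤ f x) ∧ ∀ x ∈ K, f x - 2 * ε ≤ F x := by
  classical
  have hd {y : E} (hy : y ∈ U) : DifferentiableAt ℝ f y := (hf y hy).differentiableAt
    (hU.mem_nhds hy)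
  let T : E → E → ℝ := fun y x => f y + fderiv ℝ f y (x - y)
  obtain ⟨t, htK, ht⟩ := hK.elim_nhds_subcover (fun y => {x | f x - T y x < ε}) fun y hy => by
    have hcont : ContinuousAt (fun x => f x - T y x) y := by
      have := (hd (hKU hy)).continuousAt
      fun_prop
    exact hcont.eventually_lt continuousAt_const (by simpa [T] using hε)
  let l : Option E → E → ℝ := fun o => o.elim (fun _ => 1) T
  have hls (o : Option E) : ContDiff ℝ n (l o) := by
    cases o with
    | none => exact contDiff_const
    | some y =>
      exact contDiff_const.add
        ((fderiv ℝ f y).contDiff.comp (contDiff_id.sub contDiff_const))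
  have hlc (o : Option E) : ConvexOn ℝ Set.univ (l o) := by
    cases o with
    | none => exact convexOn_const _ convex_univ
    | some y =>
      refine ⟨convex_univ, fun u _ v _ a b _ _ hab => le_of_eq ?_⟩
      obtain rfl : b = 1 - a := by linarith
      simp only [l, T, Option.elim, map_sub, map_add, map_smul, smul_eq_mul]
      ring
  obtain ⟨F, hFs, hFc, hF⟩ := exists_contDiff_convexOn_approx_sup
    (s := Finset.insertNone t) Finset.insertNone_nonempty (fun o _ => hls o) (fun o _ => hlc o) hε
  refine ⟨F, fun x => ?_, hFc, hFs, fun x hx => ?_, fun x hx => ?_⟩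
  · have : 1 - ε ≤ F x := (hF x).1 none (by simp)
    linarith
  · obtain ⟨o, ho, hle⟩ := (hF x).2
    refine hle.trans ?_
    cases o with
    | none => exact hlb x hx
    | some y =>
      have hy := hKU (htK y (by simpa using ho))
      exact hconv.add_fderiv_le hy hx (hd hy)
  · obtain ⟨y, hy, hxy⟩ := Set.mem_iUnion₂.1 (ht hx)
    have h1 : T y x - ε ≤ F x := (hF x).1 (some y) (by simpa using hy)
    have h2 : f x - T y x < ε := hxy
    linarith

/-- A smooth convex function bounded below by `1` on an open set is the limit, in `C¹` uniformly on
compact subsets, of nonnegative smooth convex functions on the whole space lying below it. -/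
theorem ConvexOn.exists_seq_contDiff_approx {E : Type*} [NormedAddCommGroup E] [NormedSpace ℝ E]
    [ProperSpace E] {U : Set E} (hU : IsOpen U) {f : E → ℝ} {m : WithTop ℕ∞} (hm : m ≠ 0)
    (hf : ContDiffOn ℝ 1 f U) (hconv : ConvexOn ℝ U f) (hlb : ∀ x ∈ U, 1 ≤ f x) :
    ∃ F : ℕ → E → ℝ, (∀ n x, 0 ≤ F n x) ∧ (∀ n, ConvexOn ℝ Set.univ (F n)) ∧
      (∀ n, ContDiff ℝ m (F n)) ∧ (∀ n, ∀ x ∈ U, F n x ≤ f x) ∧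
      ∀ K ⊆ U, IsCompact K → TendstoUniformlyOn F f atTop K ∧
        TendstoUniformlyOn (fun n => fderiv ℝ (F n)) (fderiv ℝ f) atTop K := by
  have : LocallyCompactSpace U := hU.locallyCompactSpace
  let C : CompactExhaustion U := default
  choose F hF0 hFc hFs hFle hFK using fun n : ℕ =>
    hconv.exists_contDiff_approx_of_isCompact hU (hf.differentiableOn one_ne_zero) hlb
      (Subtype.coe_image_subset U (C n)) ((C.isCompact n).image continuous_subtype_val)
      (Nat.one_div_pos_of_nat (α := ℝ) (n := n))
      (by rw [div_le_one (by positivity)]; simp) (n := m)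
  have hlim : ∀ K ⊆ U, IsCompact K → TendstoUniformlyOn F f atTop K := by
    intro K hKU hK
    have hK' : IsCompact ((↑) ⁻¹' K : Set U) :=
      Topology.IsInducing.subtypeVal.isCompact_preimage' hK (by simpa using hKU)
    obtain ⟨N, hN⟩ := C.exists_superset_of_isCompact hK'
    rw [Metric.tendstoUniformlyOn_iff]
    intro ε hε
    have hsmall : ∀ᶠ n : ℕ in atTop, 1 / ((n : ℝ) + 1) < ε / 2 :=
      tendsto_one_div_add_atTop_nhds_zero_nat.eventually_lt_const (by positivity)
    filter_upwards [hsmall, eventually_ge_atTop N] with n hn hNn x hx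
    have h1 := hFle n x (hKU hx)
    have h2 := hFK n x ⟨⟨x, hKU hx⟩, C.subset hNn (hN hx), rfl⟩
    rw [Real.dist_eq, abs_of_nonneg (by linarith)]
    linarith
  exact ⟨F, hF0, hFc, hFs, hFle, fun K hKU hK => ⟨hlim K hKU hK,
    tendstoUniformlyOn_fderiv_of_convexOn hU hf hconv (fun n => (hFs n).differentiable hm) hFc
      hlim hKU hK⟩⟩

theorem isOpen_QPhyInt : IsOpen QPhyInt := by
  let _ : NormedRing (Matrix (Fin 3) (Fin 3) ℝ) := Matrix.frobeniusNormedRing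
  let _ : NormedAlgebra ℝ (Matrix (Fin 3) (Fin 3) ℝ) := Matrix.frobeniusNormedAlgebra
  have h := upperHemicontinuous_spectrum ℝ (Matrix (Fin 3) (Fin 3) ℝ)
  have hopen : IsOpen {Q : Matrix (Fin 3) (Fin 3) ℝ |
      spectrum ℝ Q ⊆ Set.Ioo (-(1:ℝ)/3) (2/3)} := by
    rw [isOpen_iff_mem_nhds]
    intro Q hQ
    exact (upperHemicontinuous_iff_forall_isOpen.1 h) Q _ isOpen_Ioo hQ
  exact hopen.preimage continuous_subtype_val

/-- Approximation of the singular bulk potential: if `f_b` is smooth, convex, `≥ 1` on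
`𝒬_phy°` and blows up along any sequence in `𝒬_phy°` converging to a boundary point of
`𝒬_phy`, then there is a sequence `fₙ : 𝒬 → ℝ` of nonnegative, convex, smooth functions with
`fₙ ≤ f_b` on `𝒬_phy°` such that `fₙ → f_b` and `Dfₙ → Df_b` uniformly on compact subsets of
`𝒬_phy°`. -/
theorem stmt18 (f : QSub → ℝ)
    (hsmooth : ContDiffOn ℝ (⊤ : ℕ∞) f QPhyInt)
    (hconvex : ConvexOn ℝ QPhyInt f)
    (hlb : ∀ Q ∈ QPhyInt, 1 ≤ f Q)
    (hblow : ∀ (Qseq : ℕ → QSub) (Q₀ : QSub), (∀ k, Qseq k ∈ QPhyInt) →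
      Q₀ ∈ frontier QPhy → Tendsto Qseq atTop (nhds Q₀) →
      Tendsto (fun k => f (Qseq k)) atTop atTop) :
    ∃ F : ℕ → QSub → ℝ,
      (∀ n (Q : QSub), 0 ≤ F n Q) ∧
      (∀ n, ConvexOn ℝ Set.univ (F n)) ∧
      (∀ n, ContDiff ℝ (⊤ : ℕ∞) (F n)) ∧
      (∀ n, ∀ Q ∈ QPhyInt, F n Q ≤ f Q) ∧
      (∀ K ⊆ QPhyInt, IsCompact K →
        TendstoUniformlyOn (fun n Q => F n Q) f atTop K ∧
        TendstoUniformlyOn (fun n Q => fderiv ℝ (F n) Q) (fun Q => fderiv ℝ f Q) atTop K) := by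
  exact hconvex.exists_seq_contDiff_approx isOpen_QPhyInt (by simp)
    (hsmooth.of_le (by exact_mod_cast le_top)) hlb
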